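/- arXiv:2009.13710 — 2 statements merged into one kernel-verified Lean document; each statement's English description precedes it below -/
import Mathlib

section
/- Let ℓ ≥ 2 and m ≥ 0 be integers. The ℓ vectors η_0^m, η_1^m, …, η_{ℓ-2}^m, θ_0 form a basis of the S^W-module D(B_ℓ, 2m+1)^W of W-invariant elements of D(B_ℓ, 2m+1), where W = S_ℓ is the symmetric group acting by permutation of the variables and S^W is the ring of symmetric polynomials. -/
open MvPolynomial Polynomial

noncomputable section

abbrev S (ℓ : ℕ) := MvPolynomial (Fin ℓ) ℂ

def defInt {A : Type*} [CommRing A] [Algebra ℚ A] (a b : A) (h : Polynomial A) : A :=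
  h.sum fun n c => (((n : ℚ) + 1)⁻¹ • c) * (b ^ (n + 1) - a ^ (n + 1))

def gpoly (ℓ : ℕ) : Polynomial (S ℓ) :=
  ∏ p : Fin ℓ, (Polynomial.X - Polynomial.C (MvPolynomial.X p))

def eta (ℓ k m : ℕ) : Fin ℓ → S ℓ := fun i =>
  ∑ j : Fin ℓ, defInt (MvPolynomial.X i) (MvPolynomial.X j)
    (Polynomial.X ^ k * gpoly ℓ ^ m)

def DBset (ℓ m : ℕ) : Set (Fin ℓ → S ℓ) :=
  {f | ∀ i j : Fin ℓ, i < j →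
    (MvPolynomial.X i - MvPolynomial.X j) ^ m ∣ f i - f j}

def theta0 (ℓ : ℕ) : Fin ℓ → S ℓ := fun _ => 1

def etaBasis (ℓ m : ℕ) : Fin ℓ → (Fin ℓ → S ℓ) := fun a =>
  if (a : ℕ) < ℓ - 1 then eta ℓ (a : ℕ) m else theta0 ℓ

/-- A vector field is W-invariant iff f_{σ(i)} = σ(f_i) for all σ ∈ S_ℓ. -/
def IsWInvariant (ℓ : ℕ) (f : Fin ℓ → S ℓ) : Prop :=
  ∀ σ : Equiv.Perm (Fin ℓ), ∀ i : Fin ℓ, f (σ i) = MvPolynomial.rename σ (f i)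

theorem X_sub_C_pow_dvd_of_derivative {A : Type*} [CommRing A] [IsDomain A] [CharZero A]
    {F : Polynomial A} {t : A} {m : ℕ} (h0 : F.eval t = 0)
    (h : (Polynomial.X - Polynomial.C t) ^ m ∣ Polynomial.derivative F) :
    (Polynomial.X - Polynomial.C t) ^ (m + 1) ∣ F := by
  by_cases hF : F = 0
  · simp [hF]
  have hd : Polynomial.derivative F ≠ 0 := by
    intro hd
    have := Polynomial.eq_C_of_derivative_eq_zero hd
    rw [this, Polynomial.eval_C] at h0
    exact hF (by rw [this, h0, Polynomial.C_0])
  rw [← Polynomial.le_rootMultiplicity_iff hd,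
    Polynomial.derivative_rootMultiplicity_of_root h0] at h
  have hpos := (Polynomial.rootMultiplicity_pos hF).2 h0
  rw [← Polynomial.le_rootMultiplicity_iff hF]
  lia

section antiderivative

variable {A : Type*} [CommRing A] [Algebra ℚ A]

/-- The formal antiderivative with zero constant term. -/
def antideriv : Polynomial A →ₗ[A] Polynomial A :=
  Polynomial.lsum fun n =>
    (Polynomial.monomial (n + 1)).comp (algebraMap ℚ A ((n : ℚ) + 1)⁻¹ • LinearMap.id)

theorem antideriv_monomial (n : ℕ) (c : A) :
    antideriv (Polynomial.monomial n c) =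
      Polynomial.monomial (n + 1) (((n : ℚ) + 1)⁻¹ • c) := by
  simp [antideriv, Algebra.smul_def, Polynomial.sum_monomial_index]

theorem defInt_eq (a b : A) (h : Polynomial A) :
    defInt a b h = (antideriv h).eval b - (antideriv h).eval a := by
  simp only [defInt, antideriv, Polynomial.lsum_apply, Polynomial.sum_def,
    Polynomial.eval_finsetSum, ← Finset.sum_sub_distrib]
  refine Finset.sum_congr rfl fun n _ => ?_
  simp [Algebra.smul_def, mul_sub]

theorem derivative_antideriv (h : Polynomial A) :
    Polynomial.derivative (antideriv h) = h := by
  induction h using Polynomial.induction_on' with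
  | add p q hp hq => simp [hp, hq]
  | monomial n c =>
    rw [antideriv_monomial, Polynomial.derivative_monomial]
    congr 1
    have h1 : ((n + 1 : ℕ) : A) = algebraMap ℚ A ((n : ℚ) + 1) := by simp
    have h2 : ((n : ℚ) + 1) ≠ 0 := by positivity
    rw [h1, Algebra.smul_def, mul_comm, ← mul_assoc, ← map_mul, mul_inv_cancel₀ h2]
    simp

theorem antideriv_derivative (F : Polynomial A) :
    antideriv (Polynomial.derivative F) = F - Polynomial.C (F.coeff 0) := by
  induction F using Polynomial.induction_on' with
  | add p q hp hq => simp [hp, hq]; ring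
  | monomial n c =>
    cases n with
    | zero => simp
    | succ n =>
      rw [Polynomial.derivative_monomial, Nat.add_sub_cancel, antideriv_monomial]
      have h1 : ((n + 1 : ℕ) : A) = algebraMap ℚ A ((n : ℚ) + 1) := by simp
      have h2 : ((n : ℚ) + 1) ≠ 0 := by positivity
      rw [h1, Algebra.smul_def, mul_comm c, ← mul_assoc, ← map_mul, inv_mul_cancel₀ h2]
      simp [Polynomial.coeff_monomial]

theorem defInt_derivative (a b : A) (F : Polynomial A) :
    defInt a b (Polynomial.derivative F) = F.eval b - F.eval a := by
  simp [defInt_eq, antideriv_derivative]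

theorem natDegree_antideriv_le (h : Polynomial A) :
    (antideriv h).natDegree ≤ h.natDegree + 1 := by
  rw [antideriv, Polynomial.lsum_apply, Polynomial.sum_def]
  refine Polynomial.natDegree_sum_le_of_forall_le _ _ fun n hn => ?_
  refine (Polynomial.natDegree_monomial_le _).trans ?_
  exact Nat.succ_le_succ (Polynomial.le_natDegree_of_mem_supp n hn)

/-- Functoriality of the definite integral under ring homomorphisms. -/
theorem map_defInt {B : Type*} [CommRing B] [Algebra ℚ B] (f : A →+* B) (a b : A)
    (h : Polynomial A) : f (defInt a b h) = defInt (f a) (f b) (h.map f) := by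
  conv_rhs => rw [← derivative_antideriv h, ← Polynomial.derivative_map, defInt_derivative]
  simp [defInt_eq, Polynomial.eval_map, Polynomial.eval₂_at_apply]

/-- Vanishing of the integrand at both end points to orders `p` and `q` forces the integral to be
divisible by the corresponding power of the length of the interval. -/
theorem pow_dvd_defInt (a b : A) (p q : ℕ) (r : Polynomial A) :
    (b - a) ^ (p + q + 1) ∣
      defInt a b ((Polynomial.X - Polynomial.C a) ^ p * (Polynomial.X - Polynomial.C b) ^ q * r) := by
  set h := (Polynomial.X - Polynomial.C a) ^ p * (Polynomial.X - Polynomial.C b) ^ q * r with hh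
  set L : Polynomial A := Polynomial.C a + Polynomial.C (b - a) * Polynomial.X with hL
  have h1 : defInt a b h = defInt 0 1 (Polynomial.derivative ((antideriv h).comp L)) := by
    rw [defInt_derivative, defInt_eq]
    simp [hL]
  have h2 : Polynomial.derivative ((antideriv h).comp L) = (b - a) ^ (p + q + 1) •
      (Polynomial.X ^ p * (Polynomial.X - 1) ^ q * r.comp L) := by
    rw [Polynomial.derivative_comp, derivative_antideriv, hh]
    have e1 : (Polynomial.X - Polynomial.C a).comp L = Polynomial.C (b - a) * Polynomial.X := by
      simp [hL]
    have e2 : (Polynomial.X - Polynomial.C b).comp L =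
        Polynomial.C (b - a) * (Polynomial.X - 1) := by
      simp [hL]; ring
    have e3 : Polynomial.derivative L = Polynomial.C (b - a) := by simp [hL]
    rw [Polynomial.mul_comp, Polynomial.mul_comp, Polynomial.pow_comp, Polynomial.pow_comp,
      e1, e2, e3, Polynomial.smul_eq_C_mul, Polynomial.C_pow,
      mul_pow, mul_pow]
    ring
  rw [h1, h2, defInt_eq, map_smul, Polynomial.eval_smul, Polynomial.eval_smul, ← smul_sub]
  exact Dvd.intro _ rfl

/-- Integrals of `h` whose end points are distinct roots of `∏ (X - x i)`: if all of them vanish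
although `h` is a multiple of the `m`-th power of that product, of small degree, then `h = 0`. -/
theorem eq_zero_of_defInt_eq_zero [IsDomain A] [CharZero A] [UniqueFactorizationMonoid A]
    {ι : Type*} [Fintype ι] [Nonempty ι]
    {x : ι → A} (hx : Function.Injective x) {m : ℕ} {h : Polynomial A}
    (hdvd : (∏ i, (Polynomial.X - Polynomial.C (x i))) ^ m ∣ h)
    (hdeg : h.natDegree + 1 < Fintype.card ι * (m + 1))
    (hint : ∀ i j, defInt (x i) (x j) h = 0) : h = 0 := by
  obtain ⟨i₀⟩ := ‹Nonempty ι›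
  set F := antideriv h - Polynomial.C ((antideriv h).eval (x i₀)) with hF
  have hF' : Polynomial.derivative F = h := by simp [hF, derivative_antideriv]
  have hroot (i : ι) : F.eval (x i) = 0 := by
    simpa [hF, defInt_eq] using hint i₀ i
  have hdvd' (i : ι) : (Polynomial.X - Polynomial.C (x i)) ^ (m + 1) ∣ F := by
    refine X_sub_C_pow_dvd_of_derivative (hroot i) ?_
    have hi : Polynomial.X - Polynomial.C (x i) ∣ ∏ i, (Polynomial.X - Polynomial.C (x i)) :=
      Finset.dvd_prod_of_mem (fun i => Polynomial.X - Polynomial.C (x i)) (Finset.mem_univ i)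
    rw [hF']
    exact (pow_dvd_pow_of_dvd hi m).trans hdvd
  have hprod : ∏ i, (Polynomial.X - Polynomial.C (x i)) ^ (m + 1) ∣ F := by
    refine Fintype.prod_dvd_of_isRelPrime (fun i j hij => ?_) hdvd'
    refine IsRelPrime.pow ?_
    rw [(Polynomial.prime_X_sub_C (x i)).irreducible.isRelPrime_iff_not_dvd,
      Polynomial.dvd_iff_isRoot]
    simpa [sub_eq_zero] using hx.ne hij
  have hF0 : F = 0 := by
    by_contra hne
    have := Polynomial.natDegree_le_of_dvd hprod hne
    rw [Finset.prod_pow, Polynomial.natDegree_pow, Polynomial.natDegree_finsetProd_X_sub_C_eq_card]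
      at this
    have h2 : F.natDegree ≤ h.natDegree + 1 := by
      rw [hF, Polynomial.natDegree_sub_C]
      exact natDegree_antideriv_le h
    simp only [Finset.card_univ] at this
    rw [mul_comm] at this
    lia
  rw [← hF', hF0, Polynomial.derivative_zero]

end antiderivative

theorem pow_dvd_det_of_row_sub {R n : Type*} [CommRing R] [Fintype n] [DecidableEq n]
    (A : Matrix n n R) {i j : n} (hij : i ≠ j) {d : R} (h : ∀ k, d ∣ A i k - A j k) :
    d ∣ A.det := by
  choose u hu using h
  have h1 := Matrix.det_updateRow_add_smul_self A hij (-1)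
  have h2 : A i + (-1 : R) • A j = d • u := by
    ext k
    simp [← hu k, sub_eq_add_neg]
  rw [h2, Matrix.det_updateRow_smul] at h1
  exact Dvd.intro _ h1

section linearForms

variable {ι : Type*} [DecidableEq ι]

theorem irreducible_X_sub_X {i j : ι} (hij : i ≠ j) :
    Irreducible (MvPolynomial.X i - MvPolynomial.X j : MvPolynomial ι ℂ) := by
  have hc : MvPolynomial.coeff (Finsupp.single i 1)
      (MvPolynomial.X i - MvPolynomial.X j : MvPolynomial ι ℂ) = 1 := by
    simp [MvPolynomial.coeff_X, Finsupp.single_left_inj, hij.symm]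
  refine MvPolynomial.irreducible_of_totalDegree_eq_one ?_ fun x hx => ?_
  · refine ((MvPolynomial.isHomogeneous_X _ i).sub (MvPolynomial.isHomogeneous_X _ j)).totalDegree ?_
    intro h
    simp [h] at hc
  · exact isUnit_of_dvd_one (hc ▸ hx (Finsupp.single i 1))

theorem isRelPrime_X_sub_X {i j k l : ι} (hij : i ≠ j) (hkl : k ≠ l)
    (h : k ∉ ({i, j} : Finset ι) ∨ l ∉ ({i, j} : Finset ι)) :
    IsRelPrime (MvPolynomial.X i - MvPolynomial.X j : MvPolynomial ι ℂ)
      (MvPolynomial.X k - MvPolynomial.X l) := by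
  rw [(irreducible_X_sub_X hij).isRelPrime_iff_not_dvd]
  rintro ⟨c, hc⟩
  rcases h with h | h
  all_goals simp only [Finset.mem_insert, Finset.mem_singleton, not_or] at h
  · have := congrArg (MvPolynomial.eval (Pi.single k (1 : ℂ))) hc
    simp [Ne.symm h.1, Ne.symm h.2, hkl.symm] at this
  · have := congrArg (MvPolynomial.eval (Pi.single l (1 : ℂ))) hc
    simp [Ne.symm h.1, Ne.symm h.2, hkl] at this

end linearForms

/-- The product of the `n`-th powers of the defining forms of the braid arrangement. -/
def braidForm (ℓ n : ℕ) : S ℓ :=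
  ∏ p ∈ Finset.univ.sigma fun i : Fin ℓ => Finset.Ioi i,
    (MvPolynomial.X p.1 - MvPolynomial.X p.2) ^ n

theorem braidForm_ne_zero (ℓ n : ℕ) : braidForm ℓ n ≠ 0 := by
  refine Finset.prod_ne_zero_iff.2 fun p hp => pow_ne_zero _ ?_
  simp only [Finset.mem_sigma, Finset.mem_univ, Finset.mem_Ioi, true_and] at hp
  exact (irreducible_X_sub_X hp.ne).ne_zero

theorem totalDegree_braidForm (ℓ n : ℕ) :
    (braidForm ℓ n).totalDegree = ∑ i ∈ Finset.range ℓ, i * n := by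
  have h : (braidForm ℓ n).IsHomogeneous
      (∑ p ∈ Finset.univ.sigma fun i : Fin ℓ => Finset.Ioi i, 1 * n) :=
    MvPolynomial.IsHomogeneous.prod _ _ _ fun p _ =>
      ((MvPolynomial.isHomogeneous_X _ _).sub (MvPolynomial.isHomogeneous_X _ _)).pow n
  rw [h.totalDegree (braidForm_ne_zero ℓ n), Finset.sum_sigma]
  simp only [one_mul, Finset.sum_const, Fin.card_Ioi, smul_eq_mul]
  rw [Fin.sum_univ_eq_sum_range (fun i => (ℓ - 1 - i) * n) ℓ,
    Finset.sum_range_reflect (fun i => i * n) ℓ]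

theorem braidForm_dvd {ℓ n : ℕ} {f : S ℓ}
    (h : ∀ i j : Fin ℓ, i < j → (MvPolynomial.X i - MvPolynomial.X j) ^ n ∣ f) :
    braidForm ℓ n ∣ f := by
  refine Finset.prod_dvd_of_isRelPrime ?_ ?_
  · rintro ⟨i, j⟩ hp ⟨k, l⟩ hq hpq
    simp only [Finset.coe_sigma, Set.mem_sigma_iff, Finset.coe_univ, Set.mem_univ, true_and,
      Finset.coe_Ioi, Set.mem_Ioi] at hp hq
    refine IsRelPrime.pow (isRelPrime_X_sub_X hp.ne hq.ne ?_)
    by_contra! hcon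
    simp only [Finset.mem_insert, Finset.mem_singleton] at hcon
    apply hpq
    rcases hcon with ⟨rfl | rfl, rfl | rfl⟩ <;>
      first
      | rfl
      | exact absurd (hp.trans hq) (lt_irrefl _)
      | exact absurd hq (lt_irrefl _)
  · rintro ⟨i, j⟩ hp
    exact h i j (by simpa using hp)

theorem braidForm_dvd_det {ℓ n : ℕ} {A : Matrix (Fin ℓ) (Fin ℓ) (S ℓ)}
    (h : ∀ k, (fun i => A i k) ∈ DBset ℓ n) : braidForm ℓ n ∣ A.det :=
  braidForm_dvd fun i j hij => pow_dvd_det_of_row_sub A hij.ne fun k => h k i j hij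

theorem totalDegree_det_le {ι σ R : Type*} [CommRing R] [Fintype ι] [DecidableEq ι]
    (A : Matrix ι ι (MvPolynomial σ R)) (d : ι → ℕ) (h : ∀ i k, (A i k).totalDegree ≤ d k) :
    A.det.totalDegree ≤ ∑ k, d k := by
  rw [Matrix.det_apply']
  refine MvPolynomial.totalDegree_finsetSum_le fun s _ => ?_
  refine (MvPolynomial.totalDegree_mul _ _).trans ?_
  have h1 : ((Equiv.Perm.sign s : ℤ) : MvPolynomial σ R).totalDegree = 0 := by
    rw [← map_intCast (MvPolynomial.C : R →+* MvPolynomial σ R), MvPolynomial.totalDegree_C]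
  rw [h1, zero_add]
  exact (MvPolynomial.totalDegree_finsetProd _ _).trans (Finset.sum_le_sum fun k _ => h _ k)

/-- `p` has total degree at most `d` jointly in its own variable and those of its coefficients. -/
def JointDegreeLE {σ R : Type*} [CommRing R] (d : ℕ) (p : Polynomial (MvPolynomial σ R)) : Prop :=
  p.natDegree ≤ d ∧ ∀ n, (p.coeff n).totalDegree ≤ d - n

namespace JointDegreeLE

variable {σ R : Type*} [CommRing R] {d e : ℕ} {p q : Polynomial (MvPolynomial σ R)}

theorem mul (hp : JointDegreeLE d p) (hq : JointDegreeLE e q) : JointDegreeLE (d + e) (p * q) := by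
  refine ⟨Polynomial.natDegree_mul_le.trans (add_le_add hp.1 hq.1), fun n => ?_⟩
  rw [Polynomial.coeff_mul]
  refine MvPolynomial.totalDegree_finsetSum_le fun x hx => ?_
  rw [Finset.HasAntidiagonal.mem_antidiagonal] at hx
  by_cases h1 : d < x.1
  · simp [Polynomial.coeff_eq_zero_of_natDegree_lt (hp.1.trans_lt h1)]
  by_cases h2 : e < x.2
  · simp [Polynomial.coeff_eq_zero_of_natDegree_lt (hq.1.trans_lt h2)]
  refine (MvPolynomial.totalDegree_mul _ _).trans ((add_le_add (hp.2 _) (hq.2 _)).trans ?_)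
  lia

theorem one : JointDegreeLE 0 (1 : Polynomial (MvPolynomial σ R)) := by
  refine ⟨by simp, fun n => ?_⟩
  rw [Polynomial.coeff_one]
  split <;> simp

theorem X : JointDegreeLE 1 (Polynomial.X : Polynomial (MvPolynomial σ R)) := by
  refine ⟨Polynomial.natDegree_X_le, fun n => ?_⟩
  rw [Polynomial.coeff_X]
  split <;> simp

theorem X_sub_C [Nontrivial R] (i : σ) :
    JointDegreeLE 1 (Polynomial.X - Polynomial.C (MvPolynomial.X i : MvPolynomial σ R)) := by
  refine ⟨Polynomial.natDegree_X_sub_C_le _, fun n => ?_⟩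
  rcases n with _ | _ | n
  · simp [MvPolynomial.totalDegree_neg]
  · simp
  · simp [Polynomial.coeff_X]

theorem pow (hp : JointDegreeLE d p) (n : ℕ) : JointDegreeLE (n * d) (p ^ n) := by
  induction n with
  | zero => simpa using one
  | succ n ih => rw [pow_succ, Nat.succ_mul]; exact ih.mul hp

theorem prod {ι : Type*} (s : Finset ι) (f : ι → Polynomial (MvPolynomial σ R))
    (h : ∀ i ∈ s, JointDegreeLE 1 (f i)) : JointDegreeLE s.card (∏ i ∈ s, f i) := by
  classical
  induction s using Finset.induction_on with
  | empty => simpa using one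
  | insert a s ha ih =>
    rw [Finset.prod_insert ha, Finset.card_insert_of_notMem ha, add_comm]
    exact (h a (by simp)).mul (ih fun i hi => h i (by simp [hi]))

theorem totalDegree_defInt [Nontrivial R] [Algebra ℚ R] (hp : JointDegreeLE d p) (i j : σ) :
    (defInt (MvPolynomial.X i) (MvPolynomial.X j) p).totalDegree ≤ d + 1 := by
  refine MvPolynomial.totalDegree_finsetSum_le fun n hn => ?_
  have hn' := (Polynomial.le_natDegree_of_mem_supp n hn).trans hp.1
  refine (MvPolynomial.totalDegree_mul _ _).trans ?_
  have h1 := (MvPolynomial.totalDegree_smul_le ((n : ℚ) + 1)⁻¹ (p.coeff n)).trans (hp.2 n)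
  have h2 : (MvPolynomial.X j ^ (n + 1) - MvPolynomial.X i ^ (n + 1) :
      MvPolynomial σ R).totalDegree ≤ n + 1 := by
    refine (MvPolynomial.totalDegree_sub _ _).trans ?_
    simp
  lia

end JointDegreeLE

theorem totalDegree_eta_le (ℓ k m : ℕ) (i : Fin ℓ) :
    (eta ℓ k m i).totalDegree ≤ k + m * ℓ + 1 := by
  refine MvPolynomial.totalDegree_finsetSum_le fun j _ => ?_
  refine JointDegreeLE.totalDegree_defInt ?_ i j
  have hg : JointDegreeLE ℓ (gpoly ℓ) := by
    simpa [gpoly] using JointDegreeLE.prod Finset.univ _ fun (i : Fin ℓ) _ =>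
      JointDegreeLE.X_sub_C (R := ℂ) i
  simpa using (JointDegreeLE.X.pow k).mul (hg.pow m)

section eta

variable {ℓ : ℕ}

theorem pow_dvd_defInt_gpoly {i j : Fin ℓ} (hij : i ≠ j) (m : ℕ) (p : Polynomial (S ℓ)) :
    (MvPolynomial.X j - MvPolynomial.X i) ^ (2 * m + 1) ∣
      defInt (MvPolynomial.X i) (MvPolynomial.X j) (p * gpoly ℓ ^ m) := by
  obtain ⟨r, hr⟩ : (Polynomial.X - Polynomial.C (MvPolynomial.X i)) *
      (Polynomial.X - Polynomial.C (MvPolynomial.X j)) ∣ gpoly ℓ := by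
    rw [← Finset.prod_pair (f := fun p : Fin ℓ =>
      (Polynomial.X - Polynomial.C (MvPolynomial.X p) : Polynomial (S ℓ))) hij]
    exact Finset.prod_dvd_prod_of_subset _ _ _ (Finset.subset_univ _)
  have h := pow_dvd_defInt (MvPolynomial.X i : S ℓ) (MvPolynomial.X j) m m (p * r ^ m)
  rw [two_mul]
  convert h using 2
  rw [hr, mul_pow, mul_pow]
  ring

theorem defInt_sub_defInt {A : Type*} [CommRing A] [Algebra ℚ A] (a b c : A) (h : Polynomial A) :
    defInt a c h - defInt b c h = defInt a b h := by
  simp [defInt_eq]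

theorem eta_apply (k m : ℕ) (i : Fin ℓ) :
    eta ℓ k m i = ∑ j : Fin ℓ, defInt (MvPolynomial.X i) (MvPolynomial.X j)
      (Polynomial.X ^ k * gpoly ℓ ^ m) := rfl

theorem eta_sub_eta (k m : ℕ) (i j : Fin ℓ) :
    eta ℓ k m i - eta ℓ k m j =
      ℓ • defInt (MvPolynomial.X i) (MvPolynomial.X j) (Polynomial.X ^ k * gpoly ℓ ^ m) := by
  simp only [eta_apply, ← Finset.sum_sub_distrib, defInt_sub_defInt]
  simp

theorem eta_mem_DBset (k m : ℕ) : eta ℓ k m ∈ DBset ℓ (2 * m + 1) := by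
  intro i j hij
  rw [eta_sub_eta, nsmul_eq_mul]
  refine Dvd.dvd.mul_left ?_ _
  rw [← neg_sub, Odd.neg_pow (odd_two_mul_add_one m), neg_dvd]
  exact pow_dvd_defInt_gpoly hij.ne m _

theorem map_gpoly (σ : Equiv.Perm (Fin ℓ)) :
    (gpoly ℓ).map (MvPolynomial.rename σ : S ℓ →ₐ[ℂ] S ℓ).toRingHom = gpoly ℓ := by
  rw [gpoly, Polynomial.map_prod]
  rw [← Equiv.prod_comp σ (fun p => Polynomial.X - Polynomial.C (MvPolynomial.X p : S ℓ))]
  simp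

theorem isWInvariant_eta (k m : ℕ) : IsWInvariant ℓ (eta ℓ k m) := by
  intro σ i
  simp only [eta_apply, map_sum]
  rw [← Equiv.sum_comp σ]
  refine Finset.sum_congr rfl fun j _ => ?_
  have h := map_defInt (MvPolynomial.rename σ : S ℓ →ₐ[ℂ] S ℓ).toRingHom (MvPolynomial.X i)
    (MvPolynomial.X j) (Polynomial.X ^ k * gpoly ℓ ^ m)
  rw [Polynomial.map_mul, Polynomial.map_pow, Polynomial.map_pow, map_gpoly] at h
  simpa using h.symm

theorem etaBasis_mem_DBset (m : ℕ) (a : Fin ℓ) : etaBasis ℓ m a ∈ DBset ℓ (2 * m + 1) := by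
  rw [etaBasis]
  split
  · exact eta_mem_DBset _ m
  · intro i j _
    simp [theta0]

theorem isWInvariant_etaBasis (m : ℕ) (a : Fin ℓ) : IsWInvariant ℓ (etaBasis ℓ m a) := by
  rw [etaBasis]
  split
  · exact isWInvariant_eta _ m
  · intro σ i
    simp [theta0]

theorem etaBasis_castSucc (n m : ℕ) (k : Fin n) :
    etaBasis (n + 1) m k.castSucc = eta (n + 1) k m := by
  simp [etaBasis]

theorem etaBasis_last (n m : ℕ) : etaBasis (n + 1) m (Fin.last n) = theta0 (n + 1) := by
  simp [etaBasis]

theorem natDegree_gpoly : (gpoly ℓ).natDegree = ℓ := by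
  simp [gpoly]

theorem gpoly_ne_zero : gpoly ℓ ≠ 0 :=
  Finset.prod_ne_zero_iff.2 fun _ _ => Polynomial.X_sub_C_ne_zero _

/-- The fields of the basis are linearly independent over the whole polynomial ring. -/
theorem eq_zero_of_sum_mul_etaBasis (hℓ : 2 ≤ ℓ) (m : ℕ) (a : Fin ℓ → S ℓ)
    (h : ∀ i, ∑ k, a k * etaBasis ℓ m k i = 0) : a = 0 := by
  obtain ⟨n, rfl⟩ : ∃ n, ℓ = n + 1 := ⟨ℓ - 1, by lia⟩
  simp only [Fin.sum_univ_castSucc, etaBasis_castSucc, etaBasis_last, theta0, mul_one] at h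
  set p : Polynomial (S (n + 1)) := ∑ k : Fin n, a k.castSucc • Polynomial.X ^ (k : ℕ) with hp
  have hcoeff (k : Fin n) : p.coeff k = a k.castSucc := by
    simp [hp, Polynomial.coeff_X_pow, Fin.val_inj]
  have hpdeg : p.natDegree ≤ n - 1 := by
    refine Polynomial.natDegree_sum_le_of_forall_le _ _ fun k _ => ?_
    refine (Polynomial.natDegree_smul_le _ _).trans ?_
    rw [Polynomial.natDegree_X_pow]
    lia
  have hint (i j : Fin (n + 1)) :
      defInt (MvPolynomial.X i) (MvPolynomial.X j) (p * gpoly (n + 1) ^ m) = 0 := by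
    have h1 : ∑ k : Fin n, a k.castSucc * (eta (n + 1) k m i - eta (n + 1) k m j) = 0 := by
      simp only [mul_sub, Finset.sum_sub_distrib]
      linear_combination h i - h j
    have h2 : ∑ k : Fin n, a k.castSucc * (eta (n + 1) k m i - eta (n + 1) k m j) =
        (n + 1) • defInt (MvPolynomial.X i) (MvPolynomial.X j) (p * gpoly (n + 1) ^ m) := by
      simp only [eta_sub_eta, mul_smul_comm, ← Finset.smul_sum]
      congr 1
      simp only [hp, Finset.sum_mul, defInt_eq, smul_mul_assoc, map_sum, map_smul,
        Polynomial.eval_finsetSum, Polynomial.eval_smul, smul_eq_mul, ← Finset.sum_sub_distrib,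
        mul_sub]
    rw [h1] at h2
    exact (smul_eq_zero.1 h2.symm).resolve_left (by lia)
  have hzero : p * gpoly (n + 1) ^ m = 0 := by
    refine eq_zero_of_defInt_eq_zero (MvPolynomial.X_injective) (m := m)
      (Dvd.intro_left p rfl) ?_ hint
    have h1 := Polynomial.natDegree_mul_le (p := p) (q := gpoly (n + 1) ^ m)
    rw [Polynomial.natDegree_pow, natDegree_gpoly] at h1
    rw [Fintype.card_fin, mul_add, mul_one, mul_comm (n + 1) m]
    lia
  have hp0 : p = 0 := (mul_eq_zero.1 hzero).resolve_right (pow_ne_zero _ gpoly_ne_zero)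
  have ha (k : Fin n) : a k.castSucc = 0 := by
    rw [← hcoeff, hp0, Polynomial.coeff_zero]
  funext k
  induction k using Fin.lastCases with
  | last => simpa [ha] using h 0
  | cast k => exact ha k

/-- The matrix whose columns are the fields of the basis. -/
def etaMatrix (ℓ m : ℕ) : Matrix (Fin ℓ) (Fin ℓ) (S ℓ) :=
  Matrix.of fun i k => etaBasis ℓ m k i

theorem det_etaMatrix_ne_zero (hℓ : 2 ≤ ℓ) (m : ℕ) : (etaMatrix ℓ m).det ≠ 0 := by
  intro h
  obtain ⟨a, ha, h⟩ := Matrix.exists_mulVec_eq_zero_iff.2 h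
  refine ha (eq_zero_of_sum_mul_etaBasis hℓ m a fun i => ?_)
  simpa [Matrix.mulVec, dotProduct, etaMatrix, mul_comm] using congrFun h i

theorem totalDegree_det_etaMatrix_le (hℓ : 2 ≤ ℓ) (m : ℕ) :
    (etaMatrix ℓ m).det.totalDegree ≤ (braidForm ℓ (2 * m + 1)).totalDegree := by
  obtain ⟨n, rfl⟩ : ∃ n, ℓ = n + 1 := ⟨ℓ - 1, by lia⟩
  refine (totalDegree_det_le (etaMatrix (n + 1) m)
    (fun k => if (k : ℕ) < n then k + m * (n + 1) + 1 else 0) fun i k => ?_).trans ?_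
  · induction k using Fin.lastCases with
    | last => simp [etaMatrix, etaBasis_last, theta0]
    | cast k => simpa [etaMatrix, etaBasis_castSucc] using totalDegree_eta_le (n + 1) k m i
  · rw [totalDegree_braidForm, Fin.sum_univ_castSucc]
    simp only [Fin.val_castSucc, Fin.is_lt, if_true, Fin.val_last, lt_irrefl, if_false, add_zero]
    rw [Fin.sum_univ_eq_sum_range (fun k => k + m * (n + 1) + 1) n, ← Finset.sum_mul]
    simp only [Finset.sum_add_distrib, Finset.sum_const, Finset.card_range, smul_eq_mul]
    have h1 := Finset.sum_range_id_mul_two (n + 1)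
    rw [Finset.sum_range_succ] at h1 ⊢
    simp only [Nat.add_sub_cancel] at h1
    nlinarith

theorem exists_det_etaMatrix_eq (hℓ : 2 ≤ ℓ) (m : ℕ) :
    ∃ c : ℂ, c ≠ 0 ∧ (etaMatrix ℓ m).det = MvPolynomial.C c * braidForm ℓ (2 * m + 1) := by
  have hdet := det_etaMatrix_ne_zero hℓ m
  obtain ⟨u, hu⟩ : braidForm ℓ (2 * m + 1) ∣ (etaMatrix ℓ m).det :=
    braidForm_dvd_det fun k => etaBasis_mem_DBset m k
  have hu0 : u ≠ 0 := by
    rintro rfl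
    exact hdet (by rw [hu, mul_zero])
  have hdeg := totalDegree_det_etaMatrix_le hℓ m
  rw [hu, MvPolynomial.totalDegree_mul_of_isDomain (braidForm_ne_zero _ _) hu0] at hdeg
  have hC := MvPolynomial.totalDegree_eq_zero_iff_eq_C.1 (by lia : u.totalDegree = 0)
  refine ⟨u.coeff 0, fun h0 => hu0 (by rw [hC, h0, MvPolynomial.C_0]), ?_⟩
  rw [← hC, hu, mul_comm]

/-- The fields of the basis generate `DBset ℓ (2 * m + 1)` over the whole polynomial ring. -/
theorem exists_eq_sum_mul_etaBasis (hℓ : 2 ≤ ℓ) {m : ℕ} {v : Fin ℓ → S ℓ}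
    (hv : v ∈ DBset ℓ (2 * m + 1)) :
    ∃ a : Fin ℓ → S ℓ, ∀ i, v i = ∑ k, a k * etaBasis ℓ m k i := by
  obtain ⟨c, hc, hdet⟩ := exists_det_etaMatrix_eq hℓ m
  have hdvd (k : Fin ℓ) : braidForm ℓ (2 * m + 1) ∣ (etaMatrix ℓ m).cramer v k := by
    rw [Matrix.cramer_apply]
    refine braidForm_dvd_det fun l => ?_
    by_cases hl : l = k
    · subst hl
      simpa using hv
    · simpa [Matrix.updateCol_apply, hl, etaMatrix] using etaBasis_mem_DBset m l
  choose b hb using hdvd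
  refine ⟨fun k => MvPolynomial.C c⁻¹ * b k, fun i => ?_⟩
  have h1 := congrFun (Matrix.mulVec_cramer (etaMatrix ℓ m) v) i
  have h2 : braidForm ℓ (2 * m + 1) * ∑ k, b k * etaBasis ℓ m k i =
      braidForm ℓ (2 * m + 1) * (MvPolynomial.C c * v i) := by
    rw [Pi.smul_apply, hdet, smul_eq_mul, Matrix.mulVec, dotProduct] at h1
    rw [← mul_assoc, mul_comm _ (MvPolynomial.C c), ← h1, Finset.mul_sum]
    refine Finset.sum_congr rfl fun k _ => ?_
    rw [hb, etaMatrix, Matrix.of_apply]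
    ring
  have h3 := mul_left_cancel₀ (braidForm_ne_zero _ _) h2
  simp only [mul_assoc, ← Finset.mul_sum]
  rw [h3, ← mul_assoc, ← MvPolynomial.C_mul, inv_mul_cancel₀ hc, MvPolynomial.C_1, one_mul]

/-- The coefficients of an invariant field are symmetric. -/
theorem isSymmetric_of_eq_sum_mul_etaBasis (hℓ : 2 ≤ ℓ) {m : ℕ} {v : Fin ℓ → S ℓ}
    (hv : IsWInvariant ℓ v) {a : Fin ℓ → S ℓ} (ha : ∀ i, v i = ∑ k, a k * etaBasis ℓ m k i)
    (k : Fin ℓ) : (a k).IsSymmetric := by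
  intro σ
  have h := eq_zero_of_sum_mul_etaBasis hℓ m (fun k => MvPolynomial.rename σ (a k) - a k)
    fun i => by
      obtain ⟨i, rfl⟩ := σ.surjective i
      have h1 := hv σ i
      rw [ha, ha, map_sum] at h1
      simp only [sub_mul, Finset.sum_sub_distrib]
      rw [h1, sub_eq_zero]
      refine Finset.sum_congr rfl fun k _ => ?_
      rw [map_mul, isWInvariant_etaBasis m k σ i]
  exact sub_eq_zero.1 (congrFun h k)

end eta

theorem stmt1 (ℓ : ℕ) (hℓ : 2 ≤ ℓ) (m : ℕ) :
    (∀ a : Fin ℓ, etaBasis ℓ m a ∈ DBset ℓ (2 * m + 1) ∧ IsWInvariant ℓ (etaBasis ℓ m a)) ∧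
    LinearIndependent (symmetricSubalgebra (Fin ℓ) ℂ) (etaBasis ℓ m) ∧
    (∀ v : Fin ℓ → S ℓ, v ∈ DBset ℓ (2 * m + 1) → IsWInvariant ℓ v →
      v ∈ Submodule.span (symmetricSubalgebra (Fin ℓ) ℂ) (Set.range (etaBasis ℓ m))) := by
  refine ⟨fun a => ⟨etaBasis_mem_DBset m a, isWInvariant_etaBasis m a⟩, ?_, fun v hv hinv => ?_⟩
  · rw [Fintype.linearIndependent_iff]
    intro c hc k
    have h := eq_zero_of_sum_mul_etaBasis hℓ m (fun k => (c k : S ℓ)) fun i => by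
      simpa [Subalgebra.smul_def] using congrFun hc i
    exact Subtype.ext (congrFun h k)
  · obtain ⟨a, ha⟩ := exists_eq_sum_mul_etaBasis hℓ hv
    have hsymm := isSymmetric_of_eq_sum_mul_etaBasis hℓ hinv ha
    have hsum : v = ∑ k, (⟨a k, hsymm k⟩ : symmetricSubalgebra (Fin ℓ) ℂ) • etaBasis ℓ m k := by
      funext i
      simp [ha i, Subalgebra.smul_def]
    rw [hsum]
    exact Submodule.sum_mem _ fun k _ =>
      Submodule.smul_mem _ _ (Submodule.subset_span (Set.mem_range_self k))

end
end

section
/- Let ℓ ≥ 2 and m ≥ 1 be integers and 1 ≤ k ≤ ℓ. Applying the partial derivative ∂/∂x_k to each coefficient of η_0^m yields −m · σ_k^m; that is, for every 1 ≤ i ≤ ℓ, ∂/∂x_k (Σ_{j=1}^ℓ ∫_{x_i}^{x_j} g(t)^m dt) = −m · Σ_{j=1}^ℓ ∫_{x_i}^{x_j} g(t)^{m−1} g_k(t) dt in ℂ[x_1,…,x_ℓ]. -/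
open MvPolynomial Polynomial

noncomputable section

/-- g_k(t) = ∏_{p ≠ k} (t - x_p). -/
def gk (ℓ : ℕ) (k : Fin ℓ) : Polynomial (S ℓ) :=
  ∏ p ∈ Finset.univ.erase k, (Polynomial.X - Polynomial.C (MvPolynomial.X p))

/-- σ_k^m, the vector field with i-th coefficient ∑_j ∫_{x_i}^{x_j} g(t)^{m-1} g_k(t) dt. -/
def sigmaVF (ℓ m : ℕ) (k : Fin ℓ) : Fin ℓ → S ℓ := fun i =>
  ∑ j : Fin ℓ, defInt (MvPolynomial.X i) (MvPolynomial.X j)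
    (gpoly ℓ ^ (m - 1) * gk ℓ k)

section DefInt

variable {A : Type*} [CommRing A] [Algebra ℚ A]

lemma defInt_add (a b : A) (p q : Polynomial A) :
    defInt a b (p + q) = defInt a b p + defInt a b q := by
  unfold defInt
  apply Polynomial.sum_add_index
  · simp
  · intro n c d
    rw [smul_add, add_mul]

lemma defInt_monomial (a b : A) (n : ℕ) (c : A) :
    defInt a b (Polynomial.monomial n c) =
      (((n : ℚ) + 1)⁻¹ • c) * (b ^ (n + 1) - a ^ (n + 1)) := by
  unfold defInt
  exact Polynomial.sum_monomial_index c _ (by simp)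

lemma defInt_C_mul (a b r : A) (p : Polynomial A) :
    defInt a b (Polynomial.C r * p) = r * defInt a b p := by
  induction p using Polynomial.induction_on' with
  | add p q hp hq => rw [mul_add, defInt_add, hp, hq, defInt_add, mul_add]
  | monomial n c =>
    rw [Polynomial.C_mul_monomial, defInt_monomial, defInt_monomial, ← mul_smul_comm, mul_assoc]

end DefInt

/-- The derivation of `A[X]` that applies `d` to each coefficient. -/
def coeffDerivation {R A : Type*} [CommRing R] [CommRing A] [Algebra R A]
    (d : Derivation R A A) : Derivation R (Polynomial A) (Polynomial A) :=
  PolynomialModule.equivPolynomialSelf.compDer d.mapCoeffs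

section CoeffDerivation

variable {R A : Type*} [CommRing R] [CommRing A] [Algebra R A] (d : Derivation R A A)

lemma coeff_coeffDerivation (p : Polynomial A) (n : ℕ) :
    (coeffDerivation d p).coeff n = d (p.coeff n) := rfl

lemma coeffDerivation_monomial (n : ℕ) (c : A) :
    coeffDerivation d (Polynomial.monomial n c) = Polynomial.monomial n (d c) := by
  ext i
  rw [coeff_coeffDerivation, Polynomial.coeff_monomial, Polynomial.coeff_monomial]
  split_ifs <;> simp

lemma coeffDerivation_X_sub_C (c : A) :
    coeffDerivation d (Polynomial.X - Polynomial.C c) = -Polynomial.C (d c) := by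
  rw [map_sub, ← Polynomial.monomial_one_one_eq_X, ← Polynomial.monomial_zero_left,
    coeffDerivation_monomial, coeffDerivation_monomial]
  simp

/-- The Leibniz integral rule. -/
lemma derivation_defInt [Algebra ℚ A] (a b : A) (p : Polynomial A) :
    d (defInt a b p) =
      defInt a b (coeffDerivation d p) + p.eval b * d b - p.eval a * d a := by
  induction p using Polynomial.induction_on' with
  | add p q hp hq =>
    rw [defInt_add, map_add, hp, hq, map_add, defInt_add, Polynomial.eval_add,
      Polynomial.eval_add]
    ring
  | monomial n c =>
    have hn : ((n : ℚ) + 1)⁻¹ • ((n : A) + 1) = 1 := by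
      have h : (n : A) + 1 = ((n : ℚ) + 1) • (1 : A) := by
        rw [Algebra.smul_def]
        simp
      rw [h, smul_smul, inv_mul_cancel₀ (by positivity), one_smul]
    rw [coeffDerivation_monomial, defInt_monomial, defInt_monomial, Derivation.leibniz,
      map_rat_smul, map_sub, Derivation.leibniz_pow, Derivation.leibniz_pow]
    simp only [Polynomial.eval_monomial, smul_eq_mul, nsmul_eq_mul, Nat.add_sub_cancel,
      Nat.cast_add, Nat.cast_one]
    rw [Algebra.smul_def] at hn
    rw [Algebra.smul_def, Algebra.smul_def]
    linear_combination (c * (b ^ n * d b - a ^ n * d a)) * hn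

end CoeffDerivation

lemma gpoly_eq_mul_gk (ℓ : ℕ) (k : Fin ℓ) :
    gpoly ℓ = (Polynomial.X - Polynomial.C (MvPolynomial.X k)) * gk ℓ k :=
  (Finset.mul_prod_erase _ _ (Finset.mem_univ k)).symm

lemma eval_gpoly (ℓ : ℕ) (i : Fin ℓ) : (gpoly ℓ).eval (MvPolynomial.X i) = 0 := by
  simp [gpoly_eq_mul_gk ℓ i]

lemma coeffDerivation_pderiv_gk (ℓ : ℕ) (k : Fin ℓ) :
    coeffDerivation (MvPolynomial.pderiv (R := ℂ) k) (gk ℓ k) = 0 := by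
  refine Finset.prod_induction _
    (fun p => coeffDerivation (MvPolynomial.pderiv (R := ℂ) k) p = 0) ?_ ?_ ?_
  · intro p q hp hq
    rw [Derivation.leibniz, hp, hq, smul_zero, smul_zero, add_zero]
  · exact Derivation.map_one_eq_zero _
  · intro p hp
    rw [coeffDerivation_X_sub_C, MvPolynomial.pderiv_X_of_ne (Finset.ne_of_mem_erase hp)]
    simp

lemma coeffDerivation_pderiv_gpoly (ℓ : ℕ) (k : Fin ℓ) :
    coeffDerivation (MvPolynomial.pderiv (R := ℂ) k) (gpoly ℓ) = -gk ℓ k := by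
  rw [gpoly_eq_mul_gk ℓ k, Derivation.leibniz, coeffDerivation_pderiv_gk,
    coeffDerivation_X_sub_C, MvPolynomial.pderiv_X_self]
  simp

lemma coeffDerivation_pderiv_gpoly_pow (ℓ m : ℕ) (k : Fin ℓ) :
    coeffDerivation (MvPolynomial.pderiv (R := ℂ) k) (gpoly ℓ ^ m) =
      Polynomial.C (-(m : S ℓ)) * (gpoly ℓ ^ (m - 1) * gk ℓ k) := by
  rw [Derivation.leibniz_pow, coeffDerivation_pderiv_gpoly]
  simp only [smul_eq_mul, nsmul_eq_mul, map_neg, map_natCast]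
  ring

theorem stmt5 (ℓ : ℕ) (hℓ : 2 ≤ ℓ) (m : ℕ) (hm : 1 ≤ m) (k : Fin ℓ) :
    ∀ i : Fin ℓ,
      MvPolynomial.pderiv k (eta ℓ 0 m i) = -(m : S ℓ) * sigmaVF ℓ m k i := by
  intro i
  have hroot (j : Fin ℓ) : (gpoly ℓ ^ m).eval (MvPolynomial.X j) = 0 := by
    rw [Polynomial.eval_pow, eval_gpoly, zero_pow (by omega)]
  unfold _root_.eta sigmaVF
  rw [map_sum, Finset.mul_sum]
  refine Finset.sum_congr rfl fun j _ => ?_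
  rw [pow_zero, one_mul, derivation_defInt, hroot, hroot, coeffDerivation_pderiv_gpoly_pow,
    defInt_C_mul, zero_mul, zero_mul, add_zero, sub_zero]

end
end
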